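/- arXiv:2407.17396 — 2 statements merged into one kernel-verified Lean document; each statement's English description precedes it below -/
import Mathlib

section
/- Let 𝓚 be a finite set of simple path rules and 𝓕 a finite set of facts. Suppose there exists a relational path r₁;…;r_k connecting a and b in G_𝓕 such that r can be derived from r₁;…;r_k. Then 𝓚 ∪ 𝓕 ⊨ r(a,b). -/
/-! Setting: finite relation symbols `R`, finite entities `E`.
A fact is a triple `(r, a, b) : R × E × E` meaning `r(a,b)`.
A simple path rule is a triple `(r, r₁, r₂) : R × R × R` meaning
`r(X,Z) ← r₁(X,Y) ∧ r₂(Y,Z)`. -/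

namespace SimplePath

variable {R E : Type*}

/-- One application of the immediate consequence operator. -/
def step (𝓚 : Set (R × R × R)) (S : Set (R × E × E)) : Set (R × E × E) :=
  S ∪ {x | ∃ r r₁ r₂ : R, ∃ a b c : E,
    x = (r, a, c) ∧ (r, r₁, r₂) ∈ 𝓚 ∧ (r₁, a, b) ∈ S ∧ (r₂, b, c) ∈ S}

/-- The sequence `𝓕₀ = 𝓕`, `𝓕ᵢ = 𝓕ᵢ₋₁ ∪ {r(a,c) : …}` of the immediate
consequence operator. -/
def FIter (𝓚 : Set (R × R × R)) (𝓕 : Set (R × E × E)) : ℕ → Set (R × E × E)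
  | 0 => 𝓕
  | i + 1 => step 𝓚 (FIter 𝓚 𝓕 i)

/-- `𝓚 ∪ 𝓕 ⊨ r(a,b)`: the atom belongs to the fixpoint `𝓕*` of the (nondecreasing,
eventually constant) sequence `𝓕ᵢ`, i.e. to some `𝓕ᵢ`. -/
def Entails (𝓚 : Set (R × R × R)) (𝓕 : Set (R × E × E)) (r : R) (a b : E) : Prop :=
  ∃ i : ℕ, (r, a, b) ∈ FIter 𝓚 𝓕 i

/-- `IsRelPath 𝓕 a b [r₁, …, r_k]`: there is a relational path `r₁;…;r_k`
connecting `a` and `b` in the graph `G_𝓕`, i.e. facts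
`r₁(a,x₁), r₂(x₁,x₂), …, r_k(x_{k-1},b)` all belonging to `𝓕`. -/
inductive IsRelPath (𝓕 : Set (R × E × E)) : E → E → List R → Prop
  | single {r : R} {a b : E} : (r, a, b) ∈ 𝓕 → IsRelPath 𝓕 a b [r]
  | cons {r : R} {a x b : E} {rs : List R} :
      (r, a, x) ∈ 𝓕 → IsRelPath 𝓕 x b rs → IsRelPath 𝓕 a b (r :: rs)

/-- One-step derivation on sequences of relations: two adjacent relations
`r₁; r₂` are replaced by `s` when `𝓚` contains the rule `s(X,Z) ← r₁(X,Y) ∧ r₂(Y,Z)`. -/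
inductive DeriveStep (𝓚 : Set (R × R × R)) : List R → List R → Prop
  | step {s r₁ r₂ : R} {p q : List R} :
      (s, r₁, r₂) ∈ 𝓚 → DeriveStep 𝓚 (p ++ r₁ :: r₂ :: q) (p ++ s :: q)

/-- `r` can be derived from the sequence `rs` by a sequence of one-step derivations. -/
def Derives (𝓚 : Set (R × R × R)) (rs : List R) (r : R) : Prop :=
  Relation.ReflTransGen (DeriveStep 𝓚) rs [r]

end SimplePath

namespace SimplePath

variable {R E : Type*} {𝓚 : Set (R × R × R)} {𝓕 𝓖 : Set (R × E × E)}

theorem monotone_FIter (𝓚 : Set (R × R × R)) (𝓕 : Set (R × E × E)) : Monotone (FIter 𝓚 𝓕) :=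
  monotone_nat_of_le_succ fun _ => Set.subset_union_left

theorem Entails.of_mem {r : R} {a b : E} (h : (r, a, b) ∈ 𝓕) : Entails 𝓚 𝓕 r a b :=
  ⟨0, h⟩

/-- Entailed atoms are closed under the rules of `𝓚`. -/
theorem Entails.comp {s r₁ r₂ : R} {a b c : E} (hs : (s, r₁, r₂) ∈ 𝓚)
    (h₁ : Entails 𝓚 𝓕 r₁ a b) (h₂ : Entails 𝓚 𝓕 r₂ b c) : Entails 𝓚 𝓕 s a c := by
  obtain ⟨i, hi⟩ := h₁
  obtain ⟨j, hj⟩ := h₂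
  exact ⟨max i j + 1, Or.inr ⟨s, r₁, r₂, a, b, c, rfl, hs,
    monotone_FIter 𝓚 𝓕 (le_max_left i j) hi, monotone_FIter 𝓚 𝓕 (le_max_right i j) hj⟩⟩

theorem IsRelPath.mono (h𝓕 : 𝓕 ⊆ 𝓖) {a b : E} {rs : List R} (h : IsRelPath 𝓕 a b rs) :
    IsRelPath 𝓖 a b rs := by
  induction h with
  | single h => exact .single (h𝓕 h)
  | cons h _ ih => exact .cons (h𝓕 h) ih

/-- A set of facts closed under the rules of `𝓚` has, along with each relational path, every path
obtained from it by a one-step derivation. -/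
theorem IsRelPath.deriveStep
    (hclosed : ∀ {s r₁ r₂ : R} {a b c : E}, (s, r₁, r₂) ∈ 𝓚 →
      (r₁, a, b) ∈ 𝓕 → (r₂, b, c) ∈ 𝓕 → (s, a, c) ∈ 𝓕)
    {a b : E} {rs rs' : List R} (h : IsRelPath 𝓕 a b rs) (hstep : DeriveStep 𝓚 rs rs') :
    IsRelPath 𝓕 a b rs' := by
  obtain @⟨s, r₁, r₂, p, q, hs⟩ := hstep
  induction p generalizing a with
  | nil =>
    cases h with
    | cons h₁ h =>
      cases h with
      | single h₂ => exact .single (hclosed hs h₁ h₂)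
      | cons h₂ h => exact .cons (hclosed hs h₁ h₂) h
  | cons t p ih =>
    generalize hl : p ++ r₁ :: r₂ :: q = l at ih
    rw [List.cons_append, hl] at h
    cases h with
    | single _ => simp at hl
    | cons h₁ h => exact .cons h₁ (ih h)

theorem IsRelPath.reflTransGen_deriveStep
    (hclosed : ∀ {s r₁ r₂ : R} {a b c : E}, (s, r₁, r₂) ∈ 𝓚 →
      (r₁, a, b) ∈ 𝓕 → (r₂, b, c) ∈ 𝓕 → (s, a, c) ∈ 𝓕)
    {a b : E} {rs rs' : List R} (h : IsRelPath 𝓕 a b rs)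
    (hder : Relation.ReflTransGen (DeriveStep 𝓚) rs rs') : IsRelPath 𝓕 a b rs' := by
  induction hder with
  | refl => exact h
  | tail _ hstep ih => exact ih.deriveStep hclosed hstep

end SimplePath

open SimplePath in
/-- Lemma 1: if there is a relational path connecting `a` and `b`
in `G_𝓕` from which `r` can be derived, then `𝓚 ∪ 𝓕 ⊨ r(a,b)`. -/
theorem entails_of_exists_relPath_derives
    {R E : Type*} [Fintype R] [Fintype E]
    (𝓚 : Set (R × R × R)) (𝓕 : Set (R × E × E)) (r : R) (a b : E)
    (hpath : ∃ rs : List R, IsRelPath 𝓕 a b rs ∧ Derives 𝓚 rs r) :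
    Entails 𝓚 𝓕 r a b := by
  obtain ⟨rs, hrs, hder⟩ := hpath
  have hend : IsRelPath {x : R × E × E | Entails 𝓚 𝓕 x.1 x.2.1 x.2.2} a b [r] :=
    (hrs.mono fun _ => Entails.of_mem).reflTransGen_deriveStep Entails.comp hder
  cases hend with
  | single h => exact h
  | cons _ h => cases h
end

section
/- Let 𝓚 be a finite set of simple path rules and 𝓕 a finite set of facts. If 𝓚 ∪ 𝓕 ⊨ r(a,b), then there exists a relational path r₁;…;r_k connecting a and b in G_𝓕 such that r can be derived from r₁;…;r_k. -/
namespace SimplePath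

variable {R E : Type*} {𝓚 : Set (R × R × R)} {𝓕 : Set (R × E × E)}

theorem IsRelPath.append {a b c : E} {rs ts : List R}
    (h₁ : IsRelPath 𝓕 a b rs) (h₂ : IsRelPath 𝓕 b c ts) : IsRelPath 𝓕 a c (rs ++ ts) := by
  induction h₁ with
  | single h => exact .cons h h₂
  | cons h _ ih => exact .cons h (ih h₂)

theorem DeriveStep.append_left {rs ts : List R} (us : List R) (h : DeriveStep 𝓚 rs ts) :
    DeriveStep 𝓚 (us ++ rs) (us ++ ts) := by
  obtain @⟨_, _, _, p, q, h⟩ := h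
  simpa only [List.append_assoc] using DeriveStep.step (p := us ++ p) (q := q) h

theorem DeriveStep.append_right {rs ts : List R} (us : List R) (h : DeriveStep 𝓚 rs ts) :
    DeriveStep 𝓚 (rs ++ us) (ts ++ us) := by
  obtain @⟨_, _, _, p, q, h⟩ := h
  simpa only [List.append_assoc, List.cons_append] using DeriveStep.step (p := p) (q := q ++ us) h

theorem Derives.append {rs ts : List R} {r r₁ r₂ : R} (hr : (r, r₁, r₂) ∈ 𝓚)
    (h₁ : Derives 𝓚 rs r₁) (h₂ : Derives 𝓚 ts r₂) : Derives 𝓚 (rs ++ ts) r :=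
  ((Relation.ReflTransGen.lift (· ++ ts) (fun _ _ h => h.append_right ts) _ _ h₁).trans
    (Relation.ReflTransGen.lift ([r₁] ++ ·) (fun _ _ h => h.append_left [r₁]) _ _ h₂)).tail
    (.step (p := []) (q := []) hr)

theorem exists_relPath_derives_of_mem_FIter {i : ℕ} {r : R} {a b : E}
    (h : (r, a, b) ∈ FIter 𝓚 𝓕 i) : ∃ rs : List R, IsRelPath 𝓕 a b rs ∧ Derives 𝓚 rs r := by
  induction i generalizing r a b with
  | zero => exact ⟨[r], .single h, .refl⟩
  | succ i ih =>
    obtain h | ⟨r, r₁, r₂, a, b, c, heq, hr, h₁, h₂⟩ := h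
    · exact ih h
    · cases heq
      obtain ⟨rs, hp₁, hd₁⟩ := ih h₁
      obtain ⟨ts, hp₂, hd₂⟩ := ih h₂
      exact ⟨rs ++ ts, hp₁.append hp₂, hd₁.append hr hd₂⟩

end SimplePath

open SimplePath in
/-- Lemma 2: if `𝓚 ∪ 𝓕 ⊨ r(a,b)` then there exists a relational
path connecting `a` and `b` in `G_𝓕` from which `r` can be derived. -/
theorem exists_relPath_derives_of_entails
    {R E : Type*} [Fintype R] [Fintype E]
    (𝓚 : Set (R × R × R)) (𝓕 : Set (R × E × E)) (r : R) (a b : E)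
    (hent : Entails 𝓚 𝓕 r a b) :
    ∃ rs : List R, IsRelPath 𝓕 a b rs ∧ Derives 𝓚 rs r := by
  obtain ⟨i, hi⟩ := hent
  exact exists_relPath_derives_of_mem_FIter hi
end
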